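/- Let C be a symmetric monoidal closed category and X an object of C. For each object A of C, let D(A) denote the internal hom [A, X], and for a morphism f : A ⟶ B let D(f) : D(B) ⟶ D(A) denote the induced precomposition map on internal homs. Let p_A : A ⟶ D(D(A)) denote the double-dualization map, defined as the currying (adjoint transpose) of the composite of the braiding A ⊗ [A, X] ≅ [A, X] ⊗ A with the evaluation map [A, X] ⊗ A ⟶ X. Then for every object A, the composite p_{D(A)} ≫ D(p_A) : D(A) ⟶ D(A) is the identity on D(A). (This is the triple-dual equation of Kelly and Mac Lane, which the paper establishes for its interpretation via a single application of the Coherence rule; in the symmetric closed setting the two canonical maps of the triple-dual triangle coincide and the triangle commutes.) -/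

import Mathlib

open CategoryTheory CategoryTheory.MonoidalCategory

universe v u

variable {C : Type u} [Category.{v} C] [MonoidalCategory C] [SymmetricCategory C]
  [MonoidalClosed C]

/-- The `X`-dualization `D(A) := [A, X]` (internal hom into `X`). -/
def D (X A : C) : C := (ihom A).obj X

/-- The contravariant action of dualization: for `f : A ⟶ B`, the precomposition map
`D(f) : [B, X] ⟶ [A, X]` on internal homs. -/
def Dmap (X : C) {A B : C} (f : A ⟶ B) : D X B ⟶ D X A :=
  (MonoidalClosed.pre f).app X

/-- The double-dualization map `p_A : A ⟶ D(D(A))`, the currying of the braiding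
`[A, X] ⊗ A ≅ A ⊗ [A, X]` followed by the evaluation `A ⊗ [A, X] ⟶ X`. -/
def doubleDual (X A : C) : A ⟶ D X (D X A) :=
  MonoidalClosed.curry ((β_ ((ihom A).obj X) A).hom ≫ (ihom.ev A).app X)

/-- The triple-dual equation of Kelly and Mac Lane: the composite
`p_{D(A)} ≫ D(p_A) : D(A) ⟶ D(A)` is the identity. -/
theorem triple_dual (X A : C) :
    doubleDual X (D X A) ≫ Dmap X (doubleDual X A) = 𝟙 (D X A) := by
  unfold doubleDual Dmap D
  rw [MonoidalClosed.curry_pre_app, BraidedCategory.braiding_naturality_left_assoc,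
    MonoidalClosed.whiskerLeft_curry_ihom_ev_app, SymmetricCategory.symmetry_assoc,
    ← MonoidalClosed.uncurry_id_eq_ev, MonoidalClosed.curry_uncurry]
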